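/- arXiv:2503.15640 — 7 statements merged into one kernel-verified Lean document; each statement's English description precedes it below -/
import Mathlib

section
/- Let D ≥ 2, L ≥ 1, and consider a periodic spin chain of 2L sites with local Hilbert space ℂ^D, total Hilbert space identified with (Fin (2L) → Fin D) → ℂ. Let O be a local operator whose support is a set of at most L consecutive sites starting at site j (so that its support and the antipodal translate of its support are disjoint). Then O(j)|Ψ₀⟩ = Oᵀ(j+L)|Ψ₀⟩, where O(j) denotes O acting on sites j, j+1, …, Oᵀ is the transpose of O in the computational basis, and Oᵀ(j+L) denotes Oᵀ acting on the antipodal translate of the support (indices mod 2L). -/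
open Matrix BigOperators

/-- The site `j + k` modulo the chain length `n`. -/
def shiftSite {n : ℕ} (j : Fin n) (k : ℕ) : Fin n :=
  ⟨(j.val + k) % n, Nat.mod_lt _ (Nat.lt_of_le_of_lt (Nat.zero_le _) j.isLt)⟩

/-- Site `j` (for `j < L`) viewed as a site of the chain of length `2*L`. -/
def lo {L : ℕ} (j : Fin L) : Fin (2 * L) := ⟨j.val, by have := j.isLt; omega⟩

/-- The antipodal site `j + L` of the chain of length `2*L`. -/
def hi {L : ℕ} (j : Fin L) : Fin (2 * L) := ⟨j.val + L, by have := j.isLt; omega⟩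

/-- The crosscap state built from the `D × D` matrix `A` on a periodic chain of `2*L` sites:
its coefficient on the computational basis state `f` is `∏_{j=0}^{L-1} A (f j) (f (j+L))`. -/
noncomputable def crosscap (L D : ℕ) (A : Matrix (Fin D) (Fin D) ℂ) :
    (Fin (2 * L) → Fin D) → ℂ :=
  fun f => ∏ j : Fin L, A (f (lo j)) (f (hi j))

/-- The translate `h(j)` of a local operator `h` of range `r`, acting on the sites
`j, j+1, …, j+r-1` (mod `n`) of a periodic chain of `n` sites, and as the identity elsewhere. -/
noncomputable def localOp {n D : ℕ} (r : ℕ)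
    (h : Matrix (Fin r → Fin D) (Fin r → Fin D) ℂ) (j : Fin n) :
    Matrix (Fin n → Fin D) (Fin n → Fin D) ℂ :=
  Matrix.of fun f g =>
    h (fun k => f (shiftSite j k.val)) (fun k => g (shiftSite j k.val)) *
      ∏ i : Fin n, if (∃ k : Fin r, i = shiftSite j k.val) ∨ f i = g i then 1 else 0

/-- The `r`-fold Kronecker power `A^{⊗r}` of a `D × D` matrix `A`. -/
noncomputable def kronPow {D : ℕ} (r : ℕ) (A : Matrix (Fin D) (Fin D) ℂ) :
    Matrix (Fin r → Fin D) (Fin r → Fin D) ℂ :=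
  Matrix.of fun f g => ∏ k : Fin r, A (f k) (g k)

/-- The one-site operator `M` acting at site `j`, identity elsewhere. -/
noncomputable def oneSite {n D : ℕ} (M : Matrix (Fin D) (Fin D) ℂ) (j : Fin n) :
    Matrix (Fin n → Fin D) (Fin n → Fin D) ℂ :=
  Matrix.of fun f g => M (f j) (g j) * ∏ i : Fin n, if i = j ∨ f i = g i then 1 else 0

theorem shiftSite_half_half {L : ℕ} (i : Fin (2 * L)) : shiftSite (shiftSite i L) L = i := by
  have := i.isLt
  ext
  simp only [shiftSite, Nat.mod_add_mod]
  rw [show i.val + L + L = i.val + 2 * L by omega, Nat.add_mod_right, Nat.mod_eq_of_lt this]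

theorem shiftSite_shiftSite_comm {n : ℕ} (j : Fin n) (k l : ℕ) :
    shiftSite (shiftSite j k) l = shiftSite (shiftSite j l) k := by
  ext
  simp only [shiftSite, Nat.mod_add_mod]
  rw [Nat.add_right_comm]

theorem shiftSite_half_ne {L r : ℕ} (hr : r ≤ L) (j : Fin (2 * L)) (k l : Fin r) :
    shiftSite (shiftSite j k.val) L ≠ shiftSite j l.val := by
  intro h
  have hk := k.isLt
  have hl := l.isLt
  have h' : j.val + (k.val + L) ≡ j.val + l.val [MOD 2 * L] := by
    simpa only [Nat.ModEq, shiftSite, Fin.mk.injEq, Nat.mod_add_mod, Nat.add_assoc] using h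
  have h'' := Nat.ModEq.add_left_cancel' _ h'
  have := Nat.ModEq.eq_of_lt_of_lt h'' (by omega) (by omega)
  omega

theorem crosscap_one_apply (L D : ℕ) (f : Fin (2 * L) → Fin D) :
    crosscap L D 1 f = if ∀ i, f i = f (shiftSite i L) then 1 else 0 := by
  have hlo (k : Fin L) : shiftSite (lo k) L = hi k := by
    have := k.isLt
    ext
    simp only [shiftSite, lo, hi]
    exact Nat.mod_eq_of_lt (by omega)
  have hiff : (∀ i, f i = f (shiftSite i L)) ↔ ∀ k : Fin L, f (lo k) = f (hi k) := by
    refine ⟨fun h k => hlo k ▸ h (lo k), fun h i => ?_⟩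
    have := i.isLt
    by_cases hi' : i.val < L
    · rw [show i = lo ⟨i.val, hi'⟩ from rfl, hlo]
      exact h _
    · have hi2 : i = hi ⟨i.val - L, by omega⟩ := by
        ext
        simp only [hi]
        omega
      rw [hi2, ← hlo, shiftSite_half_half, hlo]
      exact (h _).symm
  simp only [crosscap, Matrix.one_apply, Finset.prod_ite_zero, Finset.prod_const_one, hiff,
    Finset.mem_univ, true_imp_iff]

theorem localOp_apply {n D r : ℕ} (h : Matrix (Fin r → Fin D) (Fin r → Fin D) ℂ) (j : Fin n)
    (f g : Fin n → Fin D) [Decidable (∀ i, (∃ k : Fin r, i = shiftSite j k.val) ∨ f i = g i)] :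
    localOp r h j f g =
      if ∀ i, (∃ k : Fin r, i = shiftSite j k.val) ∨ f i = g i then
        h (fun k => f (shiftSite j k.val)) (fun k => g (shiftSite j k.val)) else 0 := by
  simp only [localOp, Matrix.of_apply, Finset.prod_ite_zero, Finset.prod_const_one,
    Finset.mem_univ, true_imp_iff, mul_ite, mul_one, mul_zero]
  congr

open Classical in
/-- A local operator of range at most `L` maps the identity crosscap state to the state whose
coefficients are the matrix elements of the operator between the support and its antipode. -/
theorem localOp_mulVec_crosscap_one {D L r : ℕ} (hr : r ≤ L)
    (O : Matrix (Fin r → Fin D) (Fin r → Fin D) ℂ) (j : Fin (2 * L)) (f : Fin (2 * L) → Fin D) :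
    (localOp r O j).mulVec (crosscap L D 1) f =
      if ∀ i, (∃ k : Fin r, i = shiftSite j k.val) ∨
          (∃ k : Fin r, i = shiftSite (shiftSite j L) k.val) ∨ f i = f (shiftSite i L) then
        O (fun k => f (shiftSite j k.val)) (fun k => f (shiftSite (shiftSite j L) k.val))
      else 0 := by
  have hanti (i : Fin (2 * L)) (hi : ∃ k : Fin r, i = shiftSite j k.val) :
      ¬ ∃ k : Fin r, shiftSite i L = shiftSite j k.val := by
    obtain ⟨k, rfl⟩ := hi
    rintro ⟨l, hl⟩
    exact shiftSite_half_ne hr j k l hl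
  have hmem (i : Fin (2 * L)) : (∃ k : Fin r, i = shiftSite (shiftSite j L) k.val) ↔
      ∃ k : Fin r, shiftSite i L = shiftSite j k.val := by
    refine exists_congr fun k => ⟨?_, fun h => ?_⟩
    · rintro rfl
      rw [shiftSite_shiftSite_comm j, shiftSite_half_half]
    · rw [← shiftSite_half_half i, h, shiftSite_shiftSite_comm]
  set g₀ : Fin (2 * L) → Fin D := fun i =>
    if ∃ k : Fin r, i = shiftSite j k.val then f (shiftSite i L) else f i with hg₀
  rw [Matrix.mulVec, dotProduct, Finset.sum_eq_single g₀]
  · have h1 : ∀ i, (∃ k : Fin r, i = shiftSite j k.val) ∨ f i = g₀ i := by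
      intro i
      by_cases h : ∃ k : Fin r, i = shiftSite j k.val
      · exact Or.inl h
      · exact Or.inr (by simp only [hg₀, if_neg h])
    have h2 : (fun k : Fin r => g₀ (shiftSite j k.val)) =
        fun k => f (shiftSite (shiftSite j L) k.val) := by
      funext k
      simp only [hg₀]
      rw [if_pos ⟨k, rfl⟩, shiftSite_shiftSite_comm]
    have h3 : (∀ i, g₀ i = g₀ (shiftSite i L)) ↔
        ∀ i, (∃ k : Fin r, i = shiftSite j k.val) ∨
          (∃ k : Fin r, i = shiftSite (shiftSite j L) k.val) ∨ f i = f (shiftSite i L) := by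
      refine forall_congr' fun i => ?_
      rw [hmem]
      by_cases ha : ∃ k : Fin r, i = shiftSite j k.val
      · simp only [hg₀, if_pos ha, if_neg (hanti i ha), ha, true_or]
      · by_cases hb : ∃ k : Fin r, shiftSite i L = shiftSite j k.val
        · simp only [hg₀, if_neg ha, if_pos hb, hb, shiftSite_half_half, true_or, or_true]
        · simp only [hg₀, if_neg ha, if_neg hb, ha, hb, false_or]
    rw [localOp_apply, if_pos h1, h2, crosscap_one_apply, mul_ite, mul_one, mul_zero]
    exact if_congr h3 rfl rfl
  · intro g _ hg
    rw [localOp_apply, crosscap_one_apply]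
    split_ifs with h1 h2 <;> try simp only [mul_zero, zero_mul]
    refine absurd (funext fun i => ?_) hg
    by_cases h : ∃ k : Fin r, i = shiftSite j k.val
    · simp only [hg₀, if_pos h]
      rw [h2 i, (h1 _).resolve_left (hanti i h)]
    · simp only [hg₀, if_neg h]
      exact ((h1 i).resolve_left h).symm
  · exact fun h => absurd (Finset.mem_univ _) h

/-- operator pushing through the identity crosscap state: for a local operator `O`
of range `r ≤ L` acting at position `j`, one has `O(j)|Ψ₀⟩ = Oᵀ(j+L)|Ψ₀⟩`, where `Oᵀ` is the
transpose in the computational basis and `j+L` is the antipodal translate (mod `2L`). -/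
theorem operator_pushing (D L r : ℕ) (hD : 2 ≤ D) (hL : 1 ≤ L) (hr : r ≤ L)
    (O : Matrix (Fin r → Fin D) (Fin r → Fin D) ℂ) (j : Fin (2 * L)) :
    (localOp r O j).mulVec (crosscap L D (1 : Matrix (Fin D) (Fin D) ℂ)) =
      (localOp r Oᵀ (shiftSite j L)).mulVec (crosscap L D (1 : Matrix (Fin D) (Fin D) ℂ)) := by
  funext f
  rw [localOp_mulVec_crosscap_one hr, localOp_mulVec_crosscap_one hr, shiftSite_half_half]
  simp only [Matrix.transpose_apply, or_left_comm]
end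

section
/- Let D ≥ 2, L ≥ 1, and let T denote the one-site translation operator on the Hilbert space of a periodic chain of 2L sites with local dimension D, i.e. the linear map sending the basis state indexed by f : Fin (2L) → Fin D to the basis state indexed by f composed with the shift j ↦ j−1 (mod 2L). If A is a symmetric D×D matrix (Aᵀ = A), then T|Ψ_A⟩ = |Ψ_A⟩; if A is antisymmetric (Aᵀ = −A), then T|Ψ_A⟩ = −|Ψ_A⟩. -/
open Matrix BigOperators

/-- The one-site translation operator `T` on the Hilbert space of a periodic chain of `n` sites:
it sends the basis state indexed by `f` to the basis state indexed by `f ∘ (j ↦ j-1)`; on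
coefficient functions this means `(T ψ) f = ψ (fun j => f (j+1))`. -/
noncomputable def translateOp {n D : ℕ} (ψ : (Fin n → Fin D) → ℂ) : (Fin n → Fin D) → ℂ :=
  fun f => ψ fun j => f (shiftSite j 1)

/-- If transposing `A` multiplies it by the scalar `s`, then the one-site translation multiplies
the crosscap state of `A` by `s`. -/
theorem translateOp_crosscap {D L : ℕ} (hL : 1 ≤ L) {A : Matrix (Fin D) (Fin D) ℂ} {s : ℂ}
    (hA : Aᵀ = s • A) : translateOp (crosscap L D A) = s • crosscap L D A := by
  obtain ⟨m, rfl⟩ := Nat.exists_eq_add_of_le' hL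
  funext f
  have hA' (a b : Fin D) : A a b = s * A b a := congrFun (congrFun hA b) a
  have lo_castSucc (j : Fin m) : shiftSite (lo j.castSucc) 1 = lo j.succ := by
    ext
    simp only [shiftSite, lo, Fin.val_castSucc, Fin.val_succ]
    exact Nat.mod_eq_of_lt (by omega)
  have hi_castSucc (j : Fin m) : shiftSite (hi j.castSucc) 1 = hi j.succ := by
    ext
    simp only [shiftSite, hi, Fin.val_castSucc, Fin.val_succ]
    rw [Nat.mod_eq_of_lt (by omega)]
    omega
  have lo_last : shiftSite (lo (Fin.last m)) 1 = hi 0 := by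
    ext
    simp only [shiftSite, lo, hi, Fin.val_last, Fin.val_zero]
    rw [Nat.mod_eq_of_lt (by omega)]
    omega
  have hi_last : shiftSite (hi (Fin.last m)) 1 = lo 0 := by
    ext
    simp only [shiftSite, lo, hi, Fin.val_last, Fin.val_zero]
    rw [show m + (m + 1) + 1 = 2 * (m + 1) by ring, Nat.mod_self]
  simp only [translateOp, crosscap, Pi.smul_apply, smul_eq_mul]
  rw [Fin.prod_univ_castSucc, Fin.prod_univ_succ]
  simp only [lo_castSucc, hi_castSucc, lo_last, hi_last]
  rw [hA' (f (hi 0))]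
  ring

/-- if `A` is symmetric then the crosscap state `|Ψ_A⟩` is invariant under the
one-site translation `T`; if `A` is antisymmetric then `T|Ψ_A⟩ = -|Ψ_A⟩`. -/
theorem crosscap_translation (D L : ℕ) (hD : 2 ≤ D) (hL : 1 ≤ L)
    (A : Matrix (Fin D) (Fin D) ℂ) :
    (Aᵀ = A → translateOp (crosscap L D A) = crosscap L D A) ∧
    (Aᵀ = -A → translateOp (crosscap L D A) = -crosscap L D A) := by
  constructor
  · intro hA
    simpa using translateOp_crosscap hL (s := 1) (by simpa using hA)
  · intro hA
    simpa using translateOp_crosscap hL (s := -1) (by simpa using hA)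
end

section
/- Let L ≥ 2 and consider the antisymmetric XY Hamiltonian on a periodic chain of 2L qubits, H_XY = Σ_{j=0}^{2L−1} (X_j Y_{j+1} − Y_j X_{j+1}) with indices mod 2L, where X_j, Y_j are the Pauli matrices X, Y acting on site j. Then for every complex number c, the crosscap state |Ψ(c)⟩ built from A = diag(1, c) satisfies H_XY |Ψ(c)⟩ = 0. -/
open Matrix BigOperators

/-- The Pauli matrix `X`. -/
noncomputable def PX : Matrix (Fin 2) (Fin 2) ℂ := !![0, 1; 1, 0]

/-- The Pauli matrix `Y`. -/
noncomputable def PY : Matrix (Fin 2) (Fin 2) ℂ := !![0, -Complex.I; Complex.I, 0]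

/-- The Pauli matrix `Z`. -/
noncomputable def PZ : Matrix (Fin 2) (Fin 2) ℂ := !![1, 0; 0, -1]

/-- The spin raising operator `σ⁺ = |1⟩⟨0|`. -/
noncomputable def sigmaPlus : Matrix (Fin 2) (Fin 2) ℂ := !![0, 0; 1, 0]

/-- A one-site operator acts on a state by summing over the values at that site. -/
theorem oneSite_mulVec_apply {n D : ℕ} (M : Matrix (Fin D) (Fin D) ℂ) (j : Fin n)
    (ψ : (Fin n → Fin D) → ℂ) (f : Fin n → Fin D) :
    (oneSite M j).mulVec ψ f = ∑ a, M (f j) a * ψ (Function.update f j a) := by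
  symm
  unfold Matrix.mulVec dotProduct
  refine Fintype.sum_of_injective (fun a => Function.update f j a)
    (Function.update_injective f j) _ _ ?_ ?_
  · intro g hg
    have : ∃ i, ¬ (i = j ∨ f i = g i) := by
      by_contra! h
      refine hg ⟨g j, ?_⟩
      funext i
      by_cases hi : i = j
      · subst hi; simp
      · simpa [hi] using h i
    obtain ⟨i, hi⟩ := this
    have h0 : (∏ i : Fin n, if i = j ∨ f i = g i then (1 : ℂ) else 0) = 0 :=
      Finset.prod_eq_zero (Finset.mem_univ i) (if_neg hi)
    simp only [oneSite, Matrix.of_apply, h0, mul_zero, zero_mul]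
  · intro a
    have h1 : (∏ i : Fin n, if i = j ∨ f i = Function.update f j a i then (1 : ℂ) else 0) = 1 := by
      refine Finset.prod_eq_one fun i _ => if_pos ?_
      by_cases hi : i = j
      · exact Or.inl hi
      · exact Or.inr (by simp [hi])
    simp only [oneSite, Matrix.of_apply, h1, mul_one, Function.update_self]

/-- The bond operator `X_j Y_k - Y_j X_k` exchanges the values at the sites `j` and `k`, with an
amplitude that vanishes when they agree. -/
theorem xy_bond_mulVec_apply {n : ℕ} {j k : Fin n} (hjk : j ≠ k)
    (ψ : (Fin n → Fin 2) → ℂ) (f : Fin n → Fin 2) :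
    (oneSite PX j * oneSite PY k - oneSite PY j * oneSite PX k).mulVec ψ f =
      2 * Complex.I * (((f k).val : ℂ) - ((f j).val : ℂ)) * ψ (f ∘ Equiv.swap j k) := by
  have hswap : f ∘ Equiv.swap j k = Function.update (Function.update f j (f k)) k (f j) := by
    funext i
    simp only [Function.comp_apply, Equiv.swap_apply_def, Function.update_apply]
    split_ifs <;> simp_all
  rw [hswap, Matrix.sub_mulVec, ← Matrix.mulVec_mulVec, ← Matrix.mulVec_mulVec, Pi.sub_apply]
  simp only [oneSite_mulVec_apply, Function.update_of_ne hjk.symm, Fin.sum_univ_two]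
  generalize f j = a
  generalize f k = b
  fin_cases a <;> fin_cases b <;> simp [PX, PY] <;> ring

theorem shiftSite_val_of_lt {L : ℕ} {i : Fin (2 * L)} (h : i.val < L) :
    (shiftSite i L).val = i.val + L :=
  Nat.mod_eq_of_lt (by omega)

theorem shiftSite_val_of_le {L : ℕ} {i : Fin (2 * L)} (h : L ≤ i.val) :
    (shiftSite i L).val = i.val - L := by
  have := i.isLt
  change (i.val + L) % (2 * L) = i.val - L
  rw [Nat.mod_eq_sub_mod (by omega), Nat.mod_eq_of_lt (by omega)]
  omega

/-- The antipodal map is an involution. -/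
theorem shiftSite_involutive (L : ℕ) :
    Function.Involutive (fun i : Fin (2 * L) => shiftSite i L) := by
  intro i
  apply Fin.ext
  beta_reduce
  have := i.isLt
  rcases lt_or_ge i.val L with h | h
  · have h1 := shiftSite_val_of_lt h
    rw [shiftSite_val_of_le (by omega)]; omega
  · have h1 := shiftSite_val_of_le h
    rw [shiftSite_val_of_lt (by omega)]; omega

theorem shiftSite_comm {n : ℕ} (i : Fin n) (a b : ℕ) :
    shiftSite (shiftSite i a) b = shiftSite (shiftSite i b) a := by
  apply Fin.ext
  simp only [shiftSite, Nat.mod_add_mod]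
  rw [Nat.add_right_comm]

theorem shiftSite_lo {L : ℕ} (i : Fin L) : shiftSite (lo i) L = hi i :=
  Fin.ext (shiftSite_val_of_lt i.isLt)

theorem shiftSite_hi {L : ℕ} (i : Fin L) : shiftSite (hi i) L = lo i := by
  rw [← shiftSite_lo]
  exact shiftSite_involutive L (lo i)

theorem eq_lo_or_eq_hi {L : ℕ} (i : Fin (2 * L)) : ∃ p : Fin L, i = lo p ∨ i = hi p := by
  have := i.isLt
  rcases lt_or_ge i.val L with h | h
  · exact ⟨⟨i, h⟩, Or.inl rfl⟩
  · exact ⟨⟨i - L, by omega⟩, Or.inr (Fin.ext (by simp only [hi]; omega))⟩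

theorem sum_eq_sum_lo_add_sum_hi {L : ℕ} {M : Type*} [AddCommMonoid M] (u : Fin (2 * L) → M) :
    ∑ i, u i = ∑ p : Fin L, u (lo p) + ∑ p : Fin L, u (hi p) := by
  rw [← Equiv.sum_comp (finCongr (two_mul L).symm) u, Fin.sum_univ_add]
  congr 1
  refine Finset.sum_congr rfl fun p _ => congrArg u (Fin.ext ?_)
  simp [hi, add_comm]

/-- The crosscap state of `diag(1, c)` is supported on antipodally symmetric configurations, where
its coefficient only depends on the number of ones. -/
theorem crosscap_diagonal_apply (L : ℕ) (c : ℂ) (f : Fin (2 * L) → Fin 2) :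
    crosscap L 2 (Matrix.diagonal ![1, c]) f =
      if ∀ i, f (shiftSite i L) = f i then c ^ ((∑ i, (f i).val) / 2) else 0 := by
  split_ifs with h
  · have hlh : ∀ p : Fin L, f (hi p) = f (lo p) := fun p => by rw [← shiftSite_lo, h]
    have hN : (∑ i, (f i).val) / 2 = ∑ p : Fin L, (f (lo p)).val := by
      rw [sum_eq_sum_lo_add_sum_hi]
      simp only [hlh]
      omega
    rw [hN, ← Finset.prod_pow_eq_pow_sum]
    refine Finset.prod_congr rfl fun p _ => ?_
    rw [hlh, Matrix.diagonal_apply_eq]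
    generalize f (lo p) = a
    fin_cases a <;> simp
  · push Not at h
    obtain ⟨i, hne⟩ := h
    obtain ⟨p, rfl | rfl⟩ := eq_lo_or_eq_hi i
    · rw [shiftSite_lo] at hne
      exact Finset.prod_eq_zero (Finset.mem_univ p) (Matrix.diagonal_apply_ne _ hne.symm)
    · rw [shiftSite_hi] at hne
      exact Finset.prod_eq_zero (Finset.mem_univ p) (Matrix.diagonal_apply_ne _ hne)

/-- If exchanging two unequal values at `j` and `k` makes `f` invariant under the involution `σ`,
then so does exchanging the values at `σ j` and `σ k`, which are those at `k` and `j`. -/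
theorem comp_swap_invariant {α β : Type*} [DecidableEq α] {σ : α → α}
    (hσ : Function.Involutive σ) {j k : α} (hj : σ j ≠ j) (hk : σ k ≠ k) (hjk : σ j ≠ k)
    {f : α → β} (h : ∀ i, f (Equiv.swap j k (σ i)) = f (Equiv.swap j k i)) :
    f (σ j) = f k ∧ f (σ k) = f j ∧
      ∀ i, f (Equiv.swap (σ j) (σ k) (σ i)) = f (Equiv.swap (σ j) (σ k) i) := by
  have hkj : σ k ≠ j := fun e => hjk (by rw [← e, hσ k])
  have h1 : f (σ j) = f k := by
    simpa [Equiv.swap_apply_of_ne_of_ne hj hjk] using h j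
  have h2 : f (σ k) = f j := by
    simpa [Equiv.swap_apply_of_ne_of_ne hkj hk] using h k
  refine ⟨h1, h2, fun i => ?_⟩
  have hi := h i
  have e1 : σ i = j ↔ i = σ j := hσ.eq_iff
  have e2 : σ i = k ↔ i = σ k := hσ.eq_iff
  have e3 : σ i = σ j ↔ i = j := hσ.injective.eq_iff
  have e4 : σ i = σ k ↔ i = k := hσ.injective.eq_iff
  simp only [Equiv.swap_apply_def, e1, e2, e3, e4] at hi ⊢
  split_ifs at hi ⊢ <;> simp_all

/-- the antisymmetric XY Hamiltonian
`H_XY = Σ_j (X_j Y_{j+1} - Y_j X_{j+1})` on a periodic chain of `2L` qubits annihilates,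
for every `c ∈ ℂ`, the crosscap state `|Ψ(c)⟩` built from `A = diag(1, c)`. -/
theorem antisymmetric_xy_crosscap (L : ℕ) (hL : 2 ≤ L) (c : ℂ) :
    (∑ j : Fin (2 * L),
        (oneSite PX j * oneSite PY (shiftSite j 1) -
          oneSite PY j * oneSite PX (shiftSite j 1))).mulVec
      (crosscap L 2 (Matrix.diagonal ![1, c])) = 0 := by
  have hσ := shiftSite_involutive L
  have hnext : ∀ j : Fin (2 * L), j ≠ shiftSite j 1 ∧ shiftSite j L ≠ shiftSite j 1 ∧
      shiftSite j L ≠ j := by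
    intro j
    have := j.isLt
    have h1 : (shiftSite j 1).val = if j.val + 1 < 2 * L then j.val + 1 else 0 := by
      change (j.val + 1) % (2 * L) = _
      split_ifs with h
      · exact Nat.mod_eq_of_lt h
      · rw [show j.val + 1 = 2 * L by omega, Nat.mod_self]
    simp only [ne_eq, Fin.ext_iff, h1]
    rcases lt_or_ge j.val L with h | h
    · rw [shiftSite_val_of_lt h]; split_ifs <;> omega
    · rw [shiftSite_val_of_le h]; split_ifs <;> omega
  funext f
  rw [Matrix.sum_mulVec, Finset.sum_apply, Pi.zero_apply]
  simp only [xy_bond_mulVec_apply (hnext _).1, crosscap_diagonal_apply, Function.comp_apply,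
    Equiv.sum_comp (Equiv.swap _ _) fun i => (f i).val]
  rw [← self_eq_neg, ← Finset.sum_neg_distrib, ← Equiv.sum_comp hσ.toPerm]
  refine Finset.sum_congr rfl fun j _ => ?_
  rw [Function.Involutive.coe_toPerm, shiftSite_comm j L 1]
  have fwd := comp_swap_invariant (f := f) hσ (hnext j).2.2 (hnext (shiftSite j 1)).2.2
    (hnext j).2.1
  have bwd := comp_swap_invariant (f := f) hσ (j := shiftSite j L)
    (k := shiftSite (shiftSite j 1) L) (hnext _).2.2 (hnext _).2.2
    (by rw [shiftSite_comm j 1 L]; exact (hnext _).2.1)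
  simp only [hσ j, hσ (shiftSite j 1)] at fwd bwd
  split_ifs with h hj hj
  · obtain ⟨h1, h2, -⟩ := fwd hj
    rw [h1, h2]
    ring
  · exact absurd (bwd h).2.2 hj
  · exact absurd (fwd hj).2.2 h
  · simp
end

section
/- Let L ≥ 2 and consider the antisymmetric XY Hamiltonian on a periodic chain of 2L qubits, H_XY = Σ_{j=0}^{2L−1} (X_j Y_{j+1} − Y_j X_{j+1}) with indices mod 2L. Let |∅⟩ = ⊗_{j=0}^{2L−1}|0⟩_j and J = Σ_{j=0}^{L−1} σ⁺_j σ⁺_{j+L} with σ⁺ = |1⟩⟨0|. Then for every integer n with 0 ≤ n ≤ L, the state Jⁿ|∅⟩ is a zero-energy eigenstate: H_XY Jⁿ|∅⟩ = 0 and Jⁿ|∅⟩ ≠ 0. -/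
open Matrix BigOperators

/-- The ferromagnetic product state `|∅⟩ = ⊗_j |0⟩_j` on a chain of `2L` qubits. -/
noncomputable def ferro (L : ℕ) : (Fin (2 * L) → Fin 2) → ℂ :=
  fun f => if ∀ i, f i = 0 then 1 else 0

/-- The operator `J = Σ_{j=0}^{L-1} σ⁺_j σ⁺_{j+L}` creating antipodal doublets. -/
noncomputable def Jop (L : ℕ) : Matrix (Fin (2 * L) → Fin 2) (Fin (2 * L) → Fin 2) ℂ :=
  ∑ j : Fin L, oneSite sigmaPlus (lo j) * oneSite sigmaPlus (hi j)

/-- A one-site operator acts on a wave function by summing over the new value at its site. -/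
lemma oneSite_mulVec {n D : ℕ} (M : Matrix (Fin D) (Fin D) ℂ) (a : Fin n)
    (v : (Fin n → Fin D) → ℂ) (f : Fin n → Fin D) :
    (oneSite M a).mulVec v f = ∑ x, M (f a) x * v (Function.update f a x) := by
  symm
  refine Finset.sum_of_injOn (fun x => Function.update f a x)
    (fun x _ y _ h => Function.update_injective f a h) (fun _ _ => by simp) ?_ ?_
  · intro g _ hg
    have h : ¬ ∀ i ∈ (Finset.univ : Finset (Fin n)), i = a ∨ f i = g i := by
      intro h
      refine hg ⟨g a, by simp, ?_⟩
      funext i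
      by_cases hi : i = a
      · subst hi; simp
      · simpa [hi] using h i (by simp)
    simp only [oneSite, Matrix.of_apply, Finset.prod_ite_zero, if_neg h, mul_zero, zero_mul]
  · intro x _
    have h : ∀ i ∈ (Finset.univ : Finset (Fin n)), i = a ∨ f i = Function.update f a x i := by
      intro i _
      by_cases hi : i = a <;> simp [hi]
    simp only [oneSite, Matrix.of_apply, Finset.prod_ite_zero, if_pos h, Finset.prod_const_one,
      mul_one, Function.update_self]

/-- The bond term of the antisymmetric XY Hamiltonian exchanges the two spins of its bond. -/
lemma xyBond_mulVec {n : ℕ} {a b : Fin n} (hab : a ≠ b) (v : (Fin n → Fin 2) → ℂ)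
    (f : Fin n → Fin 2) :
    (oneSite PX a * oneSite PY b - oneSite PY a * oneSite PX b).mulVec v f =
      2 * Complex.I * (((f b).val : ℂ) - ((f a).val : ℂ)) * v (f ∘ Equiv.swap a b) := by
  have hswap : f ∘ Equiv.swap a b =
      Function.update (Function.update f a (f b)) b (f a) := by
    funext i
    by_cases hb : i = b
    · subst hb; simp
    · by_cases ha : i = a
      · subst ha; simp [hb]
      · simp [ha, hb, Equiv.swap_apply_of_ne_of_ne]
  rw [hswap, Matrix.sub_mulVec, Pi.sub_apply, ← Matrix.mulVec_mulVec, ← Matrix.mulVec_mulVec]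
  simp only [oneSite_mulVec, Fin.sum_univ_two, Function.update_of_ne hab.symm]
  generalize f a = x
  generalize f b = y
  fin_cases x <;> fin_cases y <;> simp [PX, PY] <;> ring

/-- The antipodal map `j ↦ j + L` of the chain of length `2 * L`. -/
def antipode (L : ℕ) : Equiv.Perm (Fin (2 * L)) :=
  Function.Involutive.toPerm
    (fun i => if h : i.val < L then ⟨i.val + L, by omega⟩ else ⟨i.val - L, by omega⟩)
    (by
      intro i
      apply Fin.ext
      by_cases h : i.val < L
      · simp [h]
      · have : i.val - L < L := by omega
        simp [h, this]
        omega)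

lemma antipode_val {L : ℕ} (i : Fin (2 * L)) :
    (antipode L i).val = if i.val < L then i.val + L else i.val - L := by
  change (if h : i.val < L then (⟨i.val + L, by omega⟩ : Fin (2 * L))
    else ⟨i.val - L, by omega⟩).val = _
  split_ifs <;> rfl

@[simp] lemma antipode_antipode {L : ℕ} (i : Fin (2 * L)) : antipode L (antipode L i) = i :=
  (antipode L).left_inv i

lemma antipode_lo {L : ℕ} (j : Fin L) : antipode L (lo j) = hi j :=
  Fin.ext (by simp [antipode_val, lo, hi])

lemma antipode_hi {L : ℕ} (j : Fin L) : antipode L (hi j) = lo j := by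
  rw [← antipode_lo, antipode_antipode]

lemma shiftSite_one_val {n : ℕ} (j : Fin n) :
    (shiftSite j 1).val = if j.val + 1 < n then j.val + 1 else 0 := by
  have hj := j.isLt
  simp only [shiftSite]
  split_ifs with h
  · exact Nat.mod_eq_of_lt h
  · rw [show j.val + 1 = n by omega, Nat.mod_self]

lemma antipode_shiftSite_one {L : ℕ} (j : Fin (2 * L)) :
    antipode L (shiftSite j 1) = shiftSite (antipode L j) 1 := by
  have hj := j.isLt
  apply Fin.ext
  simp only [antipode_val, shiftSite_one_val]
  split_ifs <;> omega

lemma sum_eq_sum_lo_add_hi {M : Type*} [AddCommMonoid M] {L : ℕ} (f : Fin (2 * L) → M) :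
    ∑ i, f i = ∑ j : Fin L, (f (lo j) + f (hi j)) := by
  rw [← Fin.sum_congr' f (two_mul L).symm, Fin.sum_univ_add, ← Finset.sum_add_distrib]
  refine Finset.sum_congr rfl fun j _ => ?_
  congr 2
  exact Fin.ext (Nat.add_comm _ _)

/-- The wave function of `Jⁿ|∅⟩`: it is supported on the antipodally symmetric configurations
with `2 * n` excitations. -/
noncomputable def doubletState (L n : ℕ) : (Fin (2 * L) → Fin 2) → ℂ :=
  fun f => if f ∘ antipode L = f ∧ ∑ i, (f i).val = 2 * n then (n.factorial : ℂ) else 0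

lemma ferro_eq_doubletState (L : ℕ) : ferro L = doubletState L 0 := by
  funext f
  have h : (∀ i, f i = 0) ↔ (f ∘ antipode L = f ∧ ∑ i, (f i).val = 2 * 0) := by
    simp only [mul_zero, Finset.sum_eq_zero_iff, Finset.mem_univ, true_imp_iff]
    constructor
    · intro h
      exact ⟨funext fun i => by simp [h], fun i => by simp [h]⟩
    · rintro ⟨-, h⟩ i
      exact Fin.ext (h i)
  simp only [ferro, doubletState, h, Nat.factorial_zero, Nat.cast_one]

lemma sigmaPlus_pair_mulVec {n : ℕ} {a b : Fin n} (hab : a ≠ b) (v : (Fin n → Fin 2) → ℂ)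
    (f : Fin n → Fin 2) :
    (oneSite sigmaPlus a * oneSite sigmaPlus b).mulVec v f =
      if f a = 1 ∧ f b = 1 then v (Function.update (Function.update f a 0) b 0) else 0 := by
  rw [← Matrix.mulVec_mulVec]
  simp only [oneSite_mulVec, Fin.sum_univ_two, Function.update_of_ne hab.symm]
  generalize f a = x
  generalize f b = y
  fin_cases x <;> fin_cases y <;> simp [sigmaPlus]

/-- Emptying an occupied antipodal pair of sites lowers the number of doublets by one. -/
lemma doubletState_update {L n : ℕ} (f : Fin (2 * L) → Fin 2) (j : Fin L)
    (hl : f (lo j) = 1) (hh : f (hi j) = 1) :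
    doubletState L n (Function.update (Function.update f (lo j) 0) (hi j) 0) =
      if f ∘ antipode L = f ∧ ∑ i, (f i).val = 2 * (n + 1) then (n.factorial : ℂ) else 0 := by
  have hne : lo j ≠ hi j := by
    have := j.isLt
    simp only [lo, hi, ne_eq, Fin.mk.injEq]
    omega
  set g := Function.update (Function.update f (lo j) 0) (hi j) 0 with hg
  have hgl : g (lo j) = 0 := by simp [hg, hne]
  have hgh : g (hi j) = 0 := by simp [hg]
  have hgo : ∀ i, i ≠ lo j → i ≠ hi j → g i = f i := fun i h1 h2 => by simp [hg, h1, h2]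
  have hsum : ∑ i, (f i).val = ∑ i, (g i).val + 2 := by
    have : ∀ i, (f i).val =
        (g i).val + ((if i = lo j then 1 else 0) + (if i = hi j then 1 else 0)) := by
      intro i
      by_cases h1 : i = lo j
      · subst h1; simp [hl, hgl, hne]
      · by_cases h2 : i = hi j
        · subst h2; simp [hh, hgh, hne.symm]
        · simp [h1, h2, hgo]
    simp_rw [this, Finset.sum_add_distrib]
    simp
  have hsym : g ∘ antipode L = g ↔ f ∘ antipode L = f := by
    simp only [funext_iff, Function.comp_apply]
    refine forall_congr' fun i => ?_
    by_cases h1 : i = lo j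
    · subst h1; simp [antipode_lo, hl, hh, hgl, hgh]
    · by_cases h2 : i = hi j
      · subst h2; simp [antipode_hi, hl, hh, hgl, hgh]
      · rw [hgo i h1 h2, hgo]
        · intro h
          exact h2 (by rw [← antipode_antipode i, h, antipode_lo])
        · intro h
          exact h1 (by rw [← antipode_antipode i, h, antipode_hi])
  have hcount : ∑ i, (g i).val = 2 * n ↔ ∑ i, (f i).val = 2 * (n + 1) := by omega
  simp only [doubletState, hsym, hcount]

lemma Jop_mulVec_doubletState (L n : ℕ) :
    (Jop L).mulVec (doubletState L n) = doubletState L (n + 1) := by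
  funext f
  have hne : ∀ j : Fin L, lo j ≠ hi j := fun j => by
    have := j.isLt
    simp only [lo, hi, ne_eq, Fin.mk.injEq]
    omega
  have hterm : ∀ j : Fin L,
      (oneSite sigmaPlus (lo j) * oneSite sigmaPlus (hi j)).mulVec (doubletState L n) f =
        if f ∘ antipode L = f ∧ ∑ i, (f i).val = 2 * (n + 1) then
          ((f (lo j)).val : ℂ) * (n.factorial : ℂ) else 0 := by
    intro j
    rw [sigmaPlus_pair_mulVec (hne j)]
    by_cases h : f (lo j) = 1 ∧ f (hi j) = 1
    · rw [if_pos h, doubletState_update f j h.1 h.2, h.1]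
      simp
    · rw [if_neg h]
      split_ifs with hs
      · have hlh : f (hi j) = f (lo j) := by
          rw [← antipode_lo]
          exact congrFun hs.1 (lo j)
        have h0 : f (lo j) = 0 := by
          rw [hlh, and_self] at h
          omega
        simp [h0]
      · rfl
  rw [Jop, Matrix.sum_mulVec, Finset.sum_apply]
  simp only [hterm, doubletState]
  split_ifs with hs
  · have hcount : ∑ j : Fin L, (f (lo j)).val = n + 1 := by
      have h := hs.2
      rw [sum_eq_sum_lo_add_hi] at h
      have hlh : ∀ j : Fin L, f (hi j) = f (lo j) := fun j => by
        rw [← antipode_lo]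
        exact congrFun hs.1 (lo j)
      simp only [hlh, ← two_mul, ← Finset.mul_sum] at h
      omega
    rw [← Finset.sum_mul, ← Nat.cast_sum, hcount, Nat.factorial_succ, Nat.cast_mul]
  · simp

lemma Jop_pow_mulVec_ferro (L n : ℕ) :
    (Jop L ^ n).mulVec (ferro L) = doubletState L n := by
  induction n with
  | zero => simp [ferro_eq_doubletState]
  | succ n ih => rw [pow_succ', ← Matrix.mulVec_mulVec, ih, Jop_mulVec_doubletState]

lemma doubletState_ne_zero {L n : ℕ} (hn : n ≤ L) : doubletState L n ≠ 0 := by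
  intro h
  let f : Fin (2 * L) → Fin 2 := fun i =>
    if (if i.val < L then i.val else i.val - L) < n then 1 else 0
  have hsym : f ∘ antipode L = f := by
    funext i
    have hi := i.isLt
    have : (if (antipode L i).val < L then (antipode L i).val else (antipode L i).val - L) =
        if i.val < L then i.val else i.val - L := by
      rw [antipode_val]
      split_ifs <;> omega
    simp only [f, Function.comp_apply, this]
  have hcount : ∑ i, (f i).val = 2 * n := by
    have hf : ∀ j : Fin L, (f (lo j)).val + (f (hi j)).val = if j.val < n then 2 else 0 := by
      intro j
      by_cases hj : j.val < n <;> simp [f, lo, hi, hj]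
    rw [sum_eq_sum_lo_add_hi, Finset.sum_congr rfl fun j _ => hf j,
      Fin.sum_univ_eq_sum_range (fun j => if j < n then 2 else 0) L, ← Finset.sum_filter,
      show (Finset.range L).filter (· < n) = Finset.range n by ext; simp; omega]
    simp [mul_comm]
  have := congrFun h f
  rw [doubletState, if_pos ⟨hsym, hcount⟩] at this
  exact Nat.cast_ne_zero.mpr n.factorial_ne_zero this

/-- If exchanging `a` and `b` makes `f` antipodally symmetric, then exchanging `a`, `b` and their
antipodes as well reflects `f`. -/
lemma comp_swap_comp_swap_antipode {L : ℕ} {f : Fin (2 * L) → Fin 2} {a b : Fin (2 * L)}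
    (h : (f ∘ Equiv.swap a b) ∘ antipode L = f ∘ Equiv.swap a b) (i : Fin (2 * L)) :
    f (Equiv.swap a b (Equiv.swap (antipode L a) (antipode L b) i)) = f (antipode L i) := by
  have h1 := congrFun h (Equiv.swap (antipode L a) (antipode L b) i)
  simp only [Function.comp_apply] at h1
  rw [← h1, (antipode L).injective.map_swap]
  simp

lemma symm_swap_antipode {L : ℕ} {f : Fin (2 * L) → Fin 2} {a b : Fin (2 * L)}
    (ha : antipode L a ≠ a) (hb : antipode L b ≠ b) (hab : antipode L a ≠ b)
    (h : (f ∘ Equiv.swap a b) ∘ antipode L = f ∘ Equiv.swap a b) :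
    (f ∘ Equiv.swap (antipode L a) (antipode L b)) ∘ antipode L =
      f ∘ Equiv.swap (antipode L a) (antipode L b) := by
  have hba : antipode L b ≠ a := fun h' => hab (by rw [← h', antipode_antipode])
  funext i
  simp only [Function.comp_apply]
  have hmap : Equiv.swap (antipode L a) (antipode L b) (antipode L i) =
      antipode L (Equiv.swap a b i) := ((antipode L).injective.map_swap _ _ _).symm
  rw [hmap, ← comp_swap_comp_swap_antipode h]
  have hcomm : Commute (Equiv.swap a b) (Equiv.swap (antipode L a) (antipode L b)) := by
    apply Equiv.Perm.Disjoint.commute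
    intro x
    by_cases hx : x = a ∨ x = b
    · right
      rcases hx with rfl | rfl
      · exact Equiv.swap_apply_of_ne_of_ne ha.symm hba.symm
      · exact Equiv.swap_apply_of_ne_of_ne hab.symm hb.symm
    · left
      push Not at hx
      exact Equiv.swap_apply_of_ne_of_ne hx.1 hx.2
  have := DFunLike.congr_fun hcomm.eq (Equiv.swap a b i)
  rw [Equiv.Perm.mul_apply, Equiv.Perm.mul_apply,
    ← Equiv.Perm.mul_apply (Equiv.swap a b) (Equiv.swap a b),
    Equiv.swap_mul_self, Equiv.Perm.one_apply] at this
  rw [this]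

/-- The contributions of a bond and of the antipodal bond to the energy cancel. -/
lemma bond_cancel {L n : ℕ} {f : Fin (2 * L) → Fin 2} {a b : Fin (2 * L)}
    (ha : antipode L a ≠ a) (hb : antipode L b ≠ b) (hab : antipode L a ≠ b) :
    (((f (antipode L b)).val : ℂ) - ((f (antipode L a)).val : ℂ)) *
        doubletState L n (f ∘ Equiv.swap (antipode L a) (antipode L b)) =
      -((((f b).val : ℂ) - ((f a).val : ℂ)) * doubletState L n (f ∘ Equiv.swap a b)) := by
  have hba : antipode L b ≠ a := fun h' => hab (by rw [← h', antipode_antipode])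
  have hsum : ∀ e : Equiv.Perm (Fin (2 * L)), ∑ i, ((f ∘ e) i).val = ∑ i, (f i).val :=
    fun e => Equiv.sum_comp e fun i => (f i).val
  have hiff : (f ∘ Equiv.swap (antipode L a) (antipode L b)) ∘ antipode L =
      f ∘ Equiv.swap (antipode L a) (antipode L b) ↔
      (f ∘ Equiv.swap a b) ∘ antipode L = f ∘ Equiv.swap a b := by
    refine ⟨fun h => ?_, symm_swap_antipode ha hb hab⟩
    have := symm_swap_antipode (by simpa using ha.symm) (by simpa using hb.symm)
      (by simpa using hba.symm) h
    simpa only [antipode_antipode] using this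
  simp only [doubletState, hsum, hiff]
  split_ifs with hs
  · have h1 := comp_swap_comp_swap_antipode hs.1 a
    have h2 := comp_swap_comp_swap_antipode hs.1 b
    rw [Equiv.swap_apply_of_ne_of_ne ha.symm hba.symm, Equiv.swap_apply_left] at h1
    rw [Equiv.swap_apply_of_ne_of_ne hab.symm hb.symm, Equiv.swap_apply_right] at h2
    rw [← h1, ← h2]
    ring
  · simp

/-- for every `0 ≤ n ≤ L`, the state `Jⁿ|∅⟩` is a nonzero zero-energy eigenstate
of the antisymmetric XY Hamiltonian `H_XY = Σ_j (X_j Y_{j+1} - Y_j X_{j+1})`. -/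
theorem xy_zero_modes (L : ℕ) (hL : 2 ≤ L) (n : ℕ) (hn : n ≤ L) :
    (∑ j : Fin (2 * L),
        (oneSite PX j * oneSite PY (shiftSite j 1) -
          oneSite PY j * oneSite PX (shiftSite j 1))).mulVec
      ((Jop L ^ n).mulVec (ferro L)) = 0 ∧
    (Jop L ^ n).mulVec (ferro L) ≠ 0 := by
  rw [Jop_pow_mulVec_ferro]
  refine ⟨?_, doubletState_ne_zero hn⟩
  funext f
  have hne : ∀ j : Fin (2 * L), j ≠ shiftSite j 1 := by
    intro j h
    have := congrArg Fin.val h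
    rw [shiftSite_one_val] at this
    split_ifs at this <;> omega
  have hanti : ∀ j : Fin (2 * L), antipode L j ≠ j := by
    intro j h
    have := congrArg Fin.val h
    rw [antipode_val] at this
    split_ifs at this <;> omega
  have hshift : ∀ j : Fin (2 * L), antipode L j ≠ shiftSite j 1 := by
    intro j h
    have := congrArg Fin.val h
    rw [antipode_val, shiftSite_one_val] at this
    split_ifs at this <;> omega
  rw [Matrix.sum_mulVec, Finset.sum_apply, Pi.zero_apply]
  simp only [xyBond_mulVec (hne _), mul_assoc (2 * Complex.I)]
  rw [← Finset.mul_sum]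
  refine mul_eq_zero_of_right _ (CharZero.eq_neg_self_iff.mp ?_)
  rw [← Finset.sum_neg_distrib]
  refine (Equiv.sum_comp (antipode L) _).symm.trans (Finset.sum_congr rfl fun j _ => ?_)
  rw [← antipode_shiftSite_one]
  exact bond_cancel (hanti j) (hanti _) (hshift j)
end

section
/- Let L ≥ 2 be even (so the chain length 2L is a multiple of 4) and consider a periodic chain of 2L qubits. Let V = diag(1, i), let 𝒱 = ∏_{j=0}^{2L−1} (V_j)^j where V_j acts on site j, and let H_XX = Σ_{j=0}^{2L−1} (X_j X_{j+1} + Y_j Y_{j+1}) and H_XY = Σ_{j=0}^{2L−1} (X_j Y_{j+1} − Y_j X_{j+1}), indices mod 2L. Then 𝒱 H_XX 𝒱^{−1} = H_XY. -/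
open Matrix BigOperators

/-- The one-site twist matrix `V = diag(1, i)`. -/
noncomputable def Vtwist : Matrix (Fin 2) (Fin 2) ℂ := Matrix.diagonal ![1, Complex.I]

/-- The twist operator `𝒱 = ∏_{j=0}^{2L-1} (V_j)^j`, where `V_j` is `V` acting on site `j`. -/
noncomputable def calV (L : ℕ) : Matrix (Fin (2 * L) → Fin 2) (Fin (2 * L) → Fin 2) ℂ :=
  (List.ofFn fun j : Fin (2 * L) => oneSite (Vtwist ^ (j : ℕ)) j).prod

/-- The conjugate of a one-qubit operator `M` by `diag(1, z)`. -/
noncomputable def phaseConj (z : ℂ) (M : Matrix (Fin 2) (Fin 2) ℂ) : Matrix (Fin 2) (Fin 2) ℂ :=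
  Matrix.of fun a b => ![1, z] a * M a b * (![1, z] b)⁻¹

lemma phaseConj_one (M : Matrix (Fin 2) (Fin 2) ℂ) : phaseConj 1 M = M := by
  ext a b
  fin_cases a <;> fin_cases b <;> simp [phaseConj]

lemma phaseConj_I_mul (z : ℂ) (M : Matrix (Fin 2) (Fin 2) ℂ) :
    phaseConj (Complex.I * z) M = phaseConj z (phaseConj Complex.I M) := by
  ext a b
  fin_cases a <;> fin_cases b <;> simp [phaseConj] <;> ring

lemma phaseConj_neg (z : ℂ) (M : Matrix (Fin 2) (Fin 2) ℂ) :
    phaseConj z (-M) = -phaseConj z M := by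
  ext a b
  simp [phaseConj]

lemma phaseConj_I_PX : phaseConj Complex.I PX = PY := by
  ext a b
  fin_cases a <;> fin_cases b <;> simp [phaseConj, PX, PY]

lemma phaseConj_I_PY : phaseConj Complex.I PY = -PX := by
  ext a b
  fin_cases a <;> fin_cases b <;> simp [phaseConj, PX, PY]

lemma oneSite_neg {n D : ℕ} (M : Matrix (Fin D) (Fin D) ℂ) (j : Fin n) :
    oneSite (-M) j = -oneSite M j := by
  ext f g
  simp [oneSite]

lemma oneSite_diagonal {n D : ℕ} (d : Fin D → ℂ) (j : Fin n) :
    oneSite (Matrix.diagonal d) j = Matrix.diagonal fun f : Fin n → Fin D => d (f j) := by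
  ext f g
  by_cases hfg : f = g
  · subst hfg
    simp [oneSite]
  · rw [Matrix.diagonal_apply_ne _ hfg]
    obtain ⟨i, hi⟩ := Function.ne_iff.mp hfg
    by_cases hj : f j = g j
    · have hij : i ≠ j := by
        rintro rfl
        exact hi hj
      simp only [oneSite, Matrix.of_apply]
      rw [Finset.prod_eq_zero (Finset.mem_univ i) (by simp [hij, hi]), mul_zero]
    · simp [oneSite, Matrix.diagonal_apply_ne _ hj]

lemma diagonal_prod_mul_oneSite {n : ℕ} (z : Fin n → ℂ) (hz : ∀ i, z i ≠ 0)
    (M : Matrix (Fin 2) (Fin 2) ℂ) (j : Fin n) :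
    Matrix.diagonal (fun f : Fin n → Fin 2 => ∏ i, ![1, z i] (f i)) * oneSite M j =
      oneSite (phaseConj (z j) M) j *
        Matrix.diagonal (fun f : Fin n → Fin 2 => ∏ i, ![1, z i] (f i)) := by
  ext f g
  rw [Matrix.diagonal_mul, Matrix.mul_diagonal]
  simp only [oneSite, phaseConj, Matrix.of_apply]
  by_cases h : ∀ i, i = j ∨ f i = g i
  · have hoff : ∏ i ∈ Finset.univ.erase j, ![1, z i] (f i) =
        ∏ i ∈ Finset.univ.erase j, ![1, z i] (g i) :=
      Finset.prod_congr rfl fun i hi => by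
        rw [(h i).resolve_left (Finset.ne_of_mem_erase hi)]
    have hne : ![1, z j] (g j) ≠ 0 := by
      generalize g j = b
      fin_cases b <;> simp [hz]
    rw [← Finset.mul_prod_erase _ _ (Finset.mem_univ j),
      ← Finset.mul_prod_erase _ (fun i => ![1, z i] (g i)) (Finset.mem_univ j), hoff]
    field_simp
  · push Not at h
    obtain ⟨i, hij, hi⟩ := h
    have hzero : (∏ i, if i = j ∨ f i = g i then (1 : ℂ) else 0) = 0 :=
      Finset.prod_eq_zero (Finset.mem_univ i) (by simp [hij, hi])
    simp only [hzero, mul_zero, zero_mul]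

lemma calV_eq_diagonal (L : ℕ) :
    calV L = Matrix.diagonal fun f : Fin (2 * L) → Fin 2 =>
      ∏ j : Fin (2 * L), ![1, Complex.I ^ (j : ℕ)] (f j) := by
  have hsite (j : Fin (2 * L)) : oneSite (Vtwist ^ (j : ℕ)) j =
      Matrix.diagonalRingHom _ ℂ
        fun f : Fin (2 * L) → Fin 2 => ![1, Complex.I ^ (j : ℕ)] (f j) := by
    rw [Vtwist, Matrix.diagonal_pow, oneSite_diagonal]
    change Matrix.diagonal _ = Matrix.diagonal _
    congr 1
    ext f
    generalize f j = b
    fin_cases b <;> simp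
  have hlist : (List.ofFn fun j : Fin (2 * L) => oneSite (Vtwist ^ (j : ℕ)) j) =
      (List.ofFn fun (j : Fin (2 * L)) (f : Fin (2 * L) → Fin 2) =>
        ![1, Complex.I ^ (j : ℕ)] (f j)).map (Matrix.diagonalRingHom _ ℂ) := by
    rw [List.map_ofFn]
    exact congrArg List.ofFn (funext hsite)
  rw [calV, hlist, ← map_list_prod, List.prod_ofFn]
  change Matrix.diagonal _ = Matrix.diagonal _
  congr 1
  ext f
  simp

lemma isUnit_det_calV (L : ℕ) : IsUnit (calV L).det := by
  rw [calV_eq_diagonal, Matrix.det_diagonal, isUnit_iff_ne_zero]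
  refine Finset.prod_ne_zero_iff.mpr fun f _ => Finset.prod_ne_zero_iff.mpr fun j _ => ?_
  generalize f j = b
  fin_cases b <;> simp

lemma calV_mul_oneSite (L : ℕ) (M : Matrix (Fin 2) (Fin 2) ℂ) (j : Fin (2 * L)) :
    calV L * oneSite M j = oneSite (phaseConj (Complex.I ^ (j : ℕ)) M) j * calV L := by
  rw [calV_eq_diagonal]
  exact diagonal_prod_mul_oneSite (fun i : Fin (2 * L) => Complex.I ^ (i : ℕ)) (by simp) M j

lemma I_pow_shiftSite_one {n : ℕ} (hn : 4 ∣ n) (j : Fin n) :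
    Complex.I ^ (shiftSite j 1 : ℕ) = Complex.I * Complex.I ^ (j : ℕ) := by
  rw [← pow_succ', Complex.I_pow_eq_pow_mod (shiftSite j 1 : ℕ),
    Complex.I_pow_eq_pow_mod ((j : ℕ) + 1)]
  simp only [shiftSite, Nat.mod_mod_of_dvd _ hn]

/-- The antisymmetric XY coupling is invariant under a common power of the twist on both sites. -/
lemma xy_coupling_phaseConj_I_pow {n : ℕ} (k : ℕ) (i j : Fin n) :
    oneSite (phaseConj (Complex.I ^ k) PX) i * oneSite (phaseConj (Complex.I ^ k) PY) j -
        oneSite (phaseConj (Complex.I ^ k) PY) i * oneSite (phaseConj (Complex.I ^ k) PX) j =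
      oneSite PX i * oneSite PY j - oneSite PY i * oneSite PX j := by
  induction k with
  | zero => simp only [pow_zero, phaseConj_one]
  | succ k ih =>
    rw [← ih]
    simp only [pow_succ', phaseConj_I_mul, phaseConj_I_PX, phaseConj_I_PY, phaseConj_neg,
      oneSite_neg]
    noncomm_ring

/-- for even `L ≥ 2` (chain length `2L` a multiple of 4), conjugation by the twist
operator `𝒱` maps the XX Hamiltonian to the antisymmetric XY Hamiltonian:
`𝒱 H_XX 𝒱⁻¹ = H_XY`. -/
theorem twist_maps_xx_to_xy (L : ℕ) (hL : 2 ≤ L) (hLeven : Even L) :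
    calV L *
        (∑ j : Fin (2 * L),
          (oneSite PX j * oneSite PX (shiftSite j 1) +
            oneSite PY j * oneSite PY (shiftSite j 1))) *
        (calV L)⁻¹ =
      ∑ j : Fin (2 * L),
        (oneSite PX j * oneSite PY (shiftSite j 1) -
          oneSite PY j * oneSite PX (shiftSite j 1)) := by
  have hn : 4 ∣ 2 * L := by
    obtain ⟨m, rfl⟩ := hLeven
    exact ⟨m, by ring⟩
  rw [← Matrix.mul_nonsing_inv_cancel_right (A := calV L)
    (∑ j : Fin (2 * L), (oneSite PX j * oneSite PY (shiftSite j 1) -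
      oneSite PY j * oneSite PX (shiftSite j 1))) (isUnit_det_calV L)]
  congr 1
  rw [Finset.mul_sum, Finset.sum_mul]
  refine Finset.sum_congr rfl fun j _ => ?_
  rw [← xy_coupling_phaseConj_I_pow (j : ℕ)]
  have hpair (A B : Matrix (Fin 2) (Fin 2) ℂ) :
      calV L * (oneSite A j * oneSite B (shiftSite j 1)) =
        oneSite (phaseConj (Complex.I ^ (j : ℕ)) A) j *
          oneSite (phaseConj (Complex.I ^ (j : ℕ)) (phaseConj Complex.I B)) (shiftSite j 1) *
          calV L := by
    rw [← mul_assoc, calV_mul_oneSite, mul_assoc, calV_mul_oneSite, I_pow_shiftSite_one hn,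
      phaseConj_I_mul, mul_assoc]
  rw [mul_add, hpair, hpair, phaseConj_I_PX, phaseConj_I_PY, phaseConj_neg, oneSite_neg,
    mul_neg, ← add_mul, sub_eq_add_neg]
end

section
/- Let q be the three-site operator on (ℂ²)^{⊗3} given by the mixed triple product q = S₁ · (S₂ × S₃) = Σ_{a,b,c ∈ {1,2,3}} ε_{abc} S^a₁ S^b₂ S^c₃, where (S¹, S², S³) = (X, Y, Z) are the Pauli matrices, ε is the Levi-Civita symbol, and the subscript indicates the tensor factor. Then q is antisymmetric with respect to transposition in the computational basis, qᵀ = −q, and for every 2×2 complex matrix A one has [A⊗A⊗A, q] = 0; consequently A^{⊗3} q + qᵀ A^{⊗3} = 0 for every 2×2 complex matrix A. -/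
open Matrix BigOperators

/-- The vector of Pauli matrices `(S¹, S², S³) = (X, Y, Z)`. -/
noncomputable def pauliVec : Fin 3 → Matrix (Fin 2) (Fin 2) ℂ := ![PX, PY, PZ]

/-- The Levi-Civita symbol on three indices. -/
def levicivita (a b c : Fin 3) : ℂ :=
  if (a, b, c) = (0, 1, 2) ∨ (a, b, c) = (1, 2, 0) ∨ (a, b, c) = (2, 0, 1) then 1
  else if (a, b, c) = (0, 2, 1) ∨ (a, b, c) = (2, 1, 0) ∨ (a, b, c) = (1, 0, 2) then -1
  else 0

/-- The three-site mixed triple product operator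
`q = S₁ · (S₂ × S₃) = Σ_{a,b,c} ε_{abc} S^a₁ S^b₂ S^c₃` on `(ℂ²)^{⊗3}`. -/
noncomputable def tripleQ : Matrix (Fin 3 → Fin 2) (Fin 3 → Fin 2) ℂ :=
  ∑ a : Fin 3, ∑ b : Fin 3, ∑ c : Fin 3,
    levicivita a b c •
      (oneSite (pauliVec a) (0 : Fin 3) * oneSite (pauliVec b) (1 : Fin 3) *
        oneSite (pauliVec c) (2 : Fin 3))

/-- The operator permuting the tensor factors according to `σ`. -/
noncomputable def sitePerm {D r : ℕ} (σ : Equiv.Perm (Fin r)) :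
    Matrix (Fin r → Fin D) (Fin r → Fin D) ℂ :=
  Matrix.of fun f g => if f = g ∘ σ then 1 else 0

theorem sitePerm_transpose {D r : ℕ} (σ : Equiv.Perm (Fin r)) :
    (sitePerm (D := D) σ)ᵀ = sitePerm σ⁻¹ := by
  ext f g
  have h : g = f ∘ σ ↔ f = g ∘ (σ⁻¹ : Equiv.Perm (Fin r)) :=
    eq_comm.trans (Equiv.eq_comp_symm σ f g).symm
  simp only [sitePerm, transpose_apply, of_apply, h]

theorem kronPow_mul_sitePerm {D r : ℕ} (A : Matrix (Fin D) (Fin D) ℂ)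
    (σ : Equiv.Perm (Fin r)) :
    kronPow r A * sitePerm σ = sitePerm σ * kronPow r A := by
  ext f g
  have h (x : Fin r → Fin D) : f = x ∘ σ ↔ x = f ∘ σ.symm := by
    rw [Equiv.eq_comp_symm, eq_comm]
  simp only [mul_apply, sitePerm, kronPow, of_apply, h, mul_ite, ite_mul, mul_one, one_mul,
    mul_zero, zero_mul, Finset.sum_ite_eq', Finset.mem_univ, if_true]
  rw [← Equiv.prod_comp σ (fun k => A ((f ∘ σ.symm) k) (g k))]
  simp

theorem oneSite_mul_oneSite_mul_oneSite_apply {D : ℕ} (A B C : Matrix (Fin D) (Fin D) ℂ)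
    (f g : Fin 3 → Fin D) :
    (oneSite A (0 : Fin 3) * oneSite B (1 : Fin 3) * oneSite C (2 : Fin 3)) f g =
      A (f 0) (g 0) * B (f 1) (g 1) * C (f 2) (g 2) := by
  rw [mul_apply, Finset.sum_eq_single ![g 0, g 1, f 2]]
  · rw [mul_apply, Finset.sum_eq_single ![g 0, f 1, f 2]]
    · simp [oneSite, Fin.prod_univ_three]
    · intro h _ hne
      by_contra hn
      apply hne
      simp [oneSite, Fin.prod_univ_three] at hn
      ext i
      fin_cases i <;> simp <;> grind
    · simp
  · intro h _ hne
    by_contra hn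
    apply hne
    obtain ⟨hl, hr⟩ := ne_zero_and_ne_zero_of_mul hn
    rw [mul_apply] at hl
    obtain ⟨k, -, hk⟩ := Finset.exists_ne_zero_of_sum_ne_zero hl
    have h2 : f 2 = h 2 := by
      simp [oneSite, Fin.prod_univ_three] at hk
      grind
    simp [oneSite, Fin.prod_univ_three] at hr
    ext i
    fin_cases i <;> simp_all
  · simp

theorem tripleQ_eq_sitePerm :
    tripleQ = (2 * Complex.I) • (sitePerm (finRotate 3)⁻¹ - sitePerm (finRotate 3)) := by
  ext f g
  have h1 : f = g ∘ finRotate 3 ↔ f 0 = g 1 ∧ f 1 = g 2 ∧ f 2 = g 0 := by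
    simp [funext_iff, Fin.forall_fin_succ]
  have h2 : f = g ∘ ((finRotate 3)⁻¹ : Equiv.Perm (Fin 3)) ↔
      f 0 = g 2 ∧ f 1 = g 0 ∧ f 2 = g 1 := by
    have e : ((finRotate 3)⁻¹ : Equiv.Perm (Fin 3)) 0 = 2 ∧
      ((finRotate 3)⁻¹ : Equiv.Perm (Fin 3)) 1 = 0 ∧
      ((finRotate 3)⁻¹ : Equiv.Perm (Fin 3)) 2 = 1 := by decide
    simp only [funext_iff, Fin.forall_fin_succ, Function.comp_apply]
    simp [e]
  simp only [tripleQ, Matrix.add_apply, Matrix.smul_apply, Matrix.sub_apply, sitePerm, of_apply,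
    h1, h2, oneSite_mul_oneSite_mul_oneSite_apply, Fin.sum_univ_three]
  simp only [levicivita, Prod.mk.injEq, Fin.isValue, Fin.reduceEq, and_true, and_false, or_false,
    or_true, and_self, or_self, if_true, if_false, zero_smul, add_zero, zero_add,
    one_smul, neg_smul, zero_ne_one, one_ne_zero]
  generalize f 0 = a, f 1 = b, f 2 = c, g 0 = x, g 1 = y, g 2 = z
  revert a b c x y z
  simp [Fin.forall_fin_two, pauliVec, PX, PY, PZ, two_mul]

theorem tripleQ_transpose : tripleQᵀ = -tripleQ := by
  rw [tripleQ_eq_sitePerm, transpose_smul, transpose_sub, sitePerm_transpose, sitePerm_transpose,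
    inv_inv, ← smul_neg, neg_sub]

theorem kronPow_mul_tripleQ (A : Matrix (Fin 2) (Fin 2) ℂ) :
    kronPow 3 A * tripleQ = tripleQ * kronPow 3 A := by
  rw [tripleQ_eq_sitePerm, mul_smul_comm, smul_mul_assoc, mul_sub, sub_mul,
    kronPow_mul_sitePerm, kronPow_mul_sitePerm]

/-- the mixed triple product `q = S₁·(S₂×S₃)` is antisymmetric under transposition
in the computational basis, commutes with `A⊗A⊗A` for every 2×2 complex matrix `A`, and
consequently satisfies `A^{⊗3} q + qᵀ A^{⊗3} = 0` for every 2×2 complex matrix `A`. -/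
theorem tripleQ_antisymmetric_and_commutes :
    tripleQᵀ = -tripleQ ∧
    (∀ A : Matrix (Fin 2) (Fin 2) ℂ, kronPow 3 A * tripleQ = tripleQ * kronPow 3 A) ∧
    (∀ A : Matrix (Fin 2) (Fin 2) ℂ,
      kronPow 3 A * tripleQ + tripleQᵀ * kronPow 3 A = 0) := by
  refine ⟨tripleQ_transpose, kronPow_mul_tripleQ, fun A => ?_⟩
  rw [tripleQ_transpose, neg_mul, kronPow_mul_tripleQ, add_neg_cancel]
end

section
/- Let L ≥ 4 and consider the correlated-hopping (dipole-conserving) Hamiltonian on a periodic chain of 2L qubits, H = Σ_{j=0}^{2L−1} h(j), where h is the four-site operator h = i(|0110⟩⟨1001| − |1001⟩⟨0110|) on (ℂ²)^{⊗4} and h(j) denotes its translate acting on sites j, j+1, j+2, j+3 (mod 2L). Then for every complex number c, the crosscap state |Ψ(c)⟩ built from A = diag(1, c) satisfies H |Ψ(c)⟩ = 0. -/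
open Matrix BigOperators

/-- The rank-one operator `|v⟩⟨w|` on `(ℂ²)^{⊗4}` mapping the computational basis state
`|w⟩` to `|v⟩`. -/
noncomputable def ketbra4 (v w : Fin 4 → Fin 2) :
    Matrix (Fin 4 → Fin 2) (Fin 4 → Fin 2) ℂ :=
  Matrix.of fun f g => if f = v ∧ g = w then 1 else 0

/-- The four-site correlated-hopping density `h = i(|0110⟩⟨1001| - |1001⟩⟨0110|)`. -/
noncomputable def hCorr : Matrix (Fin 4 → Fin 2) (Fin 4 → Fin 2) ℂ :=
  Complex.I • (ketbra4 ![0, 1, 1, 0] ![1, 0, 0, 1] - ketbra4 ![1, 0, 0, 1] ![0, 1, 1, 0])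

open Finset in
/-- A product over a full period of a periodic function does not depend on the starting point. -/
theorem prod_range_add_of_periodic {M : Type*} [CommMonoid M] {a : ℕ → M} {L : ℕ}
    (ha : ∀ m, a (m + L) = a m) (j : ℕ) :
    ∏ x ∈ range L, a (j + x) = ∏ x ∈ range L, a x := by
  induction j with
  | zero => simp
  | succ j ih =>
    rw [← ih]
    cases L with
    | zero => simp
    | succ K =>
      rw [prod_range_succ, prod_range_succ']
      congr 1
      · exact prod_congr rfl fun x _ => by congr 1; ring
      · rw [← ha (j + 0)]
        congr 1; ring

theorem shiftSite_shiftSite {n : ℕ} (j : Fin n) (a b : ℕ) :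
    shiftSite (shiftSite j a) b = shiftSite j (a + b) := by
  simp [shiftSite, add_assoc]

theorem shiftSite_add_self {n : ℕ} (j : Fin n) (a : ℕ) :
    shiftSite j (a + n) = shiftSite j a := by
  simp [shiftSite, ← add_assoc]

theorem shiftSite_inj {n : ℕ} (j : Fin n) {a b : ℕ} (ha : a < n) (hb : b < n) :
    shiftSite j a = shiftSite j b ↔ a = b := by
  refine ⟨fun h => ?_, fun h => by rw [h]⟩
  have h' : j.val + a ≡ j.val + b [MOD n] := congrArg Fin.val h
  exact (Nat.ModEq.add_left_cancel' _ h').eq_of_lt_of_lt ha hb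

theorem shiftSite_injective {n r : ℕ} (hr : r ≤ n) (j : Fin n) :
    Function.Injective fun k : Fin r => shiftSite j k.val := fun a b h =>
  Fin.ext ((shiftSite_inj j (a.isLt.trans_le hr) (b.isLt.trans_le hr)).1 h)

/-- A local operator acts by replacing the `r` letters of its block. -/
theorem localOp_mulVec {n D r : ℕ} (hr : r ≤ n)
    (h : Matrix (Fin r → Fin D) (Fin r → Fin D) ℂ) (j : Fin n)
    (ψ : (Fin n → Fin D) → ℂ) (f : Fin n → Fin D) :
    (localOp r h j).mulVec ψ f =
      ∑ w : Fin r → Fin D, h (fun k => f (shiftSite j k.val)) w *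
        ψ (Function.extend (fun k : Fin r => shiftSite j k.val) w f) := by
  have hs := shiftSite_injective hr j
  rw [Matrix.mulVec, dotProduct]
  symm
  apply Finset.sum_of_injOn
    (fun w => Function.extend (fun k : Fin r => shiftSite j k.val) w f)
  · intro w _ w' _ hw
    funext k
    have := congrFun hw (shiftSite j k.val)
    simpa [hs.extend_apply w f k, hs.extend_apply w' f k] using this
  · simp [Set.MapsTo]
  · intro g _ hg
    rw [localOp, Matrix.of_apply]
    by_cases hfg : ∀ i, (∃ k : Fin r, i = shiftSite j k.val) ∨ f i = g i
    · refine absurd ⟨fun k => g (shiftSite j k.val), by simp, ?_⟩ hg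
      funext i
      by_cases hi : ∃ k : Fin r, shiftSite j k.val = i
      · obtain ⟨k, rfl⟩ := hi
        exact hs.extend_apply _ f k
      · refine (Function.extend_apply' _ _ _ hi).trans ?_
        exact (hfg i).resolve_left fun ⟨k, hk⟩ => hi ⟨k, hk.symm⟩
    · obtain ⟨i, hi⟩ := not_forall.1 hfg
      rw [Finset.prod_eq_zero (Finset.mem_univ i) (if_neg hi)]
      simp
  · intro w _
    rw [localOp, Matrix.of_apply, Finset.prod_eq_one, mul_one]
    · congr 2
      funext k
      exact (hs.extend_apply w f k).symm
    · intro i _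
      refine if_pos ?_
      by_cases hi : ∃ k : Fin r, shiftSite j k.val = i
      · exact Or.inl (hi.imp fun _ => Eq.symm)
      · exact Or.inr (Function.extend_apply' _ _ _ hi).symm

/-- For symmetric `A` the crosscap state is translation invariant: the product over antipodal
pairs may start at any site. -/
theorem crosscap_eq_prod_range {L D : ℕ} {A : Matrix (Fin D) (Fin D) ℂ} (hA : A.IsSymm)
    (f : Fin (2 * L) → Fin D) (j : Fin (2 * L)) :
    crosscap L D A f =
      ∏ x ∈ Finset.range L, A (f (shiftSite j x)) (f (shiftSite j (x + L))) := by
  have hn : 0 < 2 * L := j.pos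
  let o : Fin (2 * L) := ⟨0, hn⟩
  have hj : shiftSite o j.val = j := by
    ext
    simp [shiftSite, o, Nat.mod_eq_of_lt j.isLt]
  let a : ℕ → ℂ := fun m => A (f (shiftSite o m)) (f (shiftSite o (m + L)))
  have ha : ∀ m, a (m + L) = a m := fun m => by
    simp only [a]
    rw [show m + L + L = m + 2 * L by ring, shiftSite_add_self, hA.apply]
  have hstart : crosscap L D A f = ∏ x ∈ Finset.range L, a x := by
    rw [crosscap, ← Fin.prod_univ_eq_prod_range]
    refine Finset.prod_congr rfl fun x _ => ?_
    have hlo : lo x = shiftSite o x.val := by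
      ext
      simp only [lo, shiftSite, o]
      rw [Nat.mod_eq_of_lt] <;> omega
    have hhi : hi x = shiftSite o (x.val + L) := by
      ext
      simp only [hi, shiftSite, o]
      rw [Nat.mod_eq_of_lt] <;> omega
    rw [hlo, hhi]
  rw [hstart, ← prod_range_add_of_periodic ha j.val]
  refine Finset.prod_congr rfl fun x _ => ?_
  simp only [a]
  rw [add_assoc, ← shiftSite_shiftSite o j.val x, ← shiftSite_shiftSite o j.val (x + L), hj]

/-- The crosscap coefficient after a block of `r ≤ L` letters has been replaced. -/
theorem crosscap_extend {L D r : ℕ} (hr : r ≤ L) {A : Matrix (Fin D) (Fin D) ℂ} (hA : A.IsSymm)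
    (f : Fin (2 * L) → Fin D) (j : Fin (2 * L)) (w : Fin r → Fin D) :
    crosscap L D A (Function.extend (fun k : Fin r => shiftSite j k.val) w f) =
      kronPow r A w (fun k => f (shiftSite (shiftSite j L) k.val)) *
        ∏ x ∈ Finset.range (L - r),
          A (f (shiftSite j (r + x))) (f (shiftSite j (r + x + L))) := by
  have hs := shiftSite_injective (n := 2 * L) (r := r) (by omega) j
  have hout : ∀ x, r ≤ x → x < 2 * L →
      Function.extend (fun k : Fin r => shiftSite j k.val) w f (shiftSite j x) =
        f (shiftSite j x) := fun x hx hx' => by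
    apply Function.extend_apply'
    rintro ⟨k, hk⟩
    have := (shiftSite_inj j (by omega) hx').1 hk
    omega
  rw [crosscap_eq_prod_range hA _ j,
    show Finset.range L = Finset.range (r + (L - r)) by rw [Nat.add_sub_cancel' hr],
    Finset.prod_range_add]
  congr 1
  · rw [← Fin.prod_univ_eq_prod_range
      (fun x => A (Function.extend (fun k : Fin r => shiftSite j k.val) w f (shiftSite j x))
        (Function.extend (fun k : Fin r => shiftSite j k.val) w f (shiftSite j (x + L)))),
      kronPow, Matrix.of_apply]
    refine Finset.prod_congr rfl fun k _ => ?_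
    rw [hs.extend_apply w f k, hout _ (by omega) (by omega), add_comm,
      ← shiftSite_shiftSite]
  · refine Finset.prod_congr rfl fun x hx => ?_
    have := Finset.mem_range.1 hx
    rw [hout _ (by omega) (by omega), hout _ (by omega) (by omega)]

/-- If `A` is symmetric and `h A^{⊗r}` is antisymmetric, the translation invariant Hamiltonian with
density `h` annihilates the crosscap state of `A`. -/
theorem sum_localOp_mulVec_crosscap {L D r : ℕ} (hr : r ≤ L) {A : Matrix (Fin D) (Fin D) ℂ}
    (hA : A.IsSymm) {h : Matrix (Fin r → Fin D) (Fin r → Fin D) ℂ}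
    (hh : ∀ u v, (h * kronPow r A) u v + (h * kronPow r A) v u = 0) :
    (∑ j : Fin (2 * L), localOp r h j).mulVec (crosscap L D A) = 0 := by
  funext f
  rw [Matrix.sum_mulVec, Finset.sum_apply, Pi.zero_apply]
  have hterm : ∀ j : Fin (2 * L), (localOp r h j).mulVec (crosscap L D A) f =
      (h * kronPow r A) (fun k => f (shiftSite j k.val))
        (fun k => f (shiftSite (shiftSite j L) k.val)) *
        ∏ x ∈ Finset.range (L - r),
          A (f (shiftSite j (r + x))) (f (shiftSite j (r + x + L))) := fun j => by
    rw [localOp_mulVec (by omega), Matrix.mul_apply, Finset.sum_mul]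
    exact Finset.sum_congr rfl fun w _ => by rw [crosscap_extend hr hA, mul_assoc]
  have hinv : ∀ j : Fin (2 * L), shiftSite (shiftSite j L) L = j := fun j => by
    rw [shiftSite_shiftSite, show L + L = 0 + 2 * L by ring, shiftSite_add_self]
    ext
    simp [shiftSite, Nat.mod_eq_of_lt j.isLt]
  refine Finset.sum_involution (fun j _ => shiftSite j L) (fun j _ => ?_) (fun j _ _ hj => ?_)
    (fun _ _ => Finset.mem_univ _) (fun j _ => hinv j)
  · rw [hterm, hterm, hinv]
    have hrest : ∀ x, A (f (shiftSite (shiftSite j L) (r + x)))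
        (f (shiftSite (shiftSite j L) (r + x + L))) =
        A (f (shiftSite j (r + x))) (f (shiftSite j (r + x + L))) := fun x => by
      rw [shiftSite_shiftSite, shiftSite_shiftSite,
        show L + (r + x + L) = r + x + 2 * L by ring, shiftSite_add_self, add_comm L, hA.apply]
    simp only [hrest]
    rw [← add_mul, hh, zero_mul]
  · have h0 : shiftSite j 0 = j := by
      ext
      simp [shiftSite, Nat.mod_eq_of_lt j.isLt]
    have hpos := j.pos
    have := (shiftSite_inj j (a := L) (b := 0) (by omega) hpos).1 (hj.trans h0.symm)
    omega

theorem kronPow_diagonal {D r : ℕ} (d : Fin D → ℂ) :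
    kronPow r (Matrix.diagonal d) = Matrix.diagonal fun w : Fin r → Fin D => ∏ k, d (w k) := by
  ext u v
  rw [kronPow, Matrix.of_apply]
  by_cases huv : u = v
  · subst huv
    simp
  · obtain ⟨k, hk⟩ := Function.ne_iff.1 huv
    rw [Matrix.diagonal_apply_ne _ huv]
    exact Finset.prod_eq_zero (Finset.mem_univ k) (Matrix.diagonal_apply_ne _ hk)

theorem hCorr_mul_kronPow_antisymm (c : ℂ) (u v : Fin 4 → Fin 2) :
    (hCorr * kronPow 4 (Matrix.diagonal ![1, c])) u v +
      (hCorr * kronPow 4 (Matrix.diagonal ![1, c])) v u = 0 := by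
  rw [kronPow_diagonal, Matrix.mul_diagonal, Matrix.mul_diagonal]
  have hne : (![0, 1, 1, 0] : Fin 4 → Fin 2) ≠ ![1, 0, 0, 1] := by decide
  simp only [hCorr, ketbra4, Matrix.smul_apply, Matrix.sub_apply, Matrix.of_apply, smul_eq_mul]
  by_cases h₁ : u = ![0, 1, 1, 0] ∧ v = ![1, 0, 0, 1]
  · obtain ⟨rfl, rfl⟩ := h₁
    simp [hne, hne.symm, Fin.prod_univ_four]
  · by_cases h₂ : u = ![1, 0, 0, 1] ∧ v = ![0, 1, 1, 0]
    · obtain ⟨rfl, rfl⟩ := h₂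
      simp [hne, hne.symm, Fin.prod_univ_four]
    · rw [if_neg h₁, if_neg h₂, if_neg (h₂ ∘ And.symm), if_neg (h₁ ∘ And.symm)]
      simp

/-- the correlated-hopping (dipole-conserving) Hamiltonian
`H = Σ_j h(j)` with `h = i(|0110⟩⟨1001| - |1001⟩⟨0110|)` on a periodic chain of `2L` qubits
annihilates, for every `c ∈ ℂ`, the crosscap state `|Ψ(c)⟩` built from `A = diag(1, c)`. -/
theorem correlated_hopping_crosscap (L : ℕ) (hL : 4 ≤ L) (c : ℂ) :
    (∑ j : Fin (2 * L), localOp 4 hCorr j).mulVec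
      (crosscap L 2 (Matrix.diagonal ![1, c])) = 0 :=
  sum_localOp_mulVec_crosscap hL (Matrix.isSymm_diagonal _) (hCorr_mul_kronPow_antisymm c)
end
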